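/- arXiv:1302.4544 — 3 statements merged into one kernel-verified Lean document; each statement's English description precedes it below -/
import Mathlib

section
/- High-probability visit bound for a single walk: Let G be a finite undirected simple graph on n ≥ 2 vertices in which every vertex has positive degree, and let Q be the transition matrix of the lazy simple random walk on G. Let t ≥ 1 be an integer and let y be a vertex. Suppose that for every vertex x′, ∑_{i=0}^{t} Q^i(x′, y) ≤ 8·deg(y)·√(t+1). Then for every starting vertex x, the probability that the t-step walk started at x satisfies N_t^x(y) ≥ 32·deg(y)·√(t+1)·⌈log₂ n⌉ is at most 1/n². -/
open Finset

attribute [local instance] Classical.propDecidable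

/-- The lazy simple random walk transition matrix on a graph `G`. -/
noncomputable def lazyWalk {V : Type*} [Fintype V] [DecidableEq V]
    (G : SimpleGraph V) [DecidableRel G.Adj] : Matrix V V ℝ :=
  Matrix.of fun u v =>
    if u = v then 1 / 2 else if G.Adj u v then 1 / (2 * (G.degree u : ℝ)) else 0

/-- The weight of a path `p : {0,…,t} → V` under the `t`-step walk measure
started at `x` with transition kernel `Q`. -/
noncomputable def walkWeight {V : Type*} [Fintype V] (Q : V → V → ℝ) (x : V) (t : ℕ)
    (p : Fin (t + 1) → V) : ℝ :=
  (if p 0 = x then (1 : ℝ) else 0) * ∏ i : Fin t, Q (p i.castSucc) (p i.succ)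

/-- `visits t p y` is the number of indices `0 ≤ i ≤ t` with `p i = y`. -/
noncomputable def visits {V : Type*} [Fintype V] (t : ℕ) (p : Fin (t + 1) → V) (y : V) : ℕ :=
  (Finset.univ.filter fun i => p i = y).card

/-- Probability of an event under the `t`-step walk measure started at `x`. -/
noncomputable def walkProb {V : Type*} [Fintype V] (Q : V → V → ℝ) (x : V) (t : ℕ)
    (E : (Fin (t + 1) → V) → Prop) : ℝ :=
  ∑ p : Fin (t + 1) → V, if E p then walkWeight Q x t p else 0

/-- The expectation of `exp (ε * N)`, where `N` is the number of visits to `y` of the `t`-step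
walk started at `x`. -/
noncomputable def visitMGF {V : Type*} [Fintype V] (Q : V → V → ℝ) (ε : ℝ) (y : V) (t : ℕ)
    (x : V) : ℝ :=
  ∑ p : Fin (t + 1) → V, walkWeight Q x t p * Real.exp (ε * visits t p y)

theorem lazyWalk_nonneg {V : Type*} [Fintype V] [DecidableEq V]
    (G : SimpleGraph V) [DecidableRel G.Adj] (u v : V) : 0 ≤ lazyWalk G u v := by
  simp only [lazyWalk, Matrix.of_apply]
  split_ifs <;> positivity

theorem lazyWalk_row_sum {V : Type*} [Fintype V] [DecidableEq V]
    (G : SimpleGraph V) [DecidableRel G.Adj] {u : V} (hu : 0 < G.degree u) :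
    ∑ v, lazyWalk G u v = 1 := by
  have hsplit : ∀ v, lazyWalk G u v =
      (if u = v then (1 / 2 : ℝ) else 0) +
        if G.Adj u v then 1 / (2 * (G.degree u : ℝ)) else 0 := by
    intro v
    simp only [lazyWalk, Matrix.of_apply]
    by_cases h : u = v
    · subst h; simp
    · simp [h]
  have hu' : (G.degree u : ℝ) ≠ 0 := by positivity
  rw [Finset.sum_congr rfl fun v _ => hsplit v, Finset.sum_add_distrib, Finset.sum_ite_eq,
    ← Finset.sum_filter, ← SimpleGraph.neighborFinset_eq_filter, Finset.sum_const,
    SimpleGraph.card_neighborFinset_eq_degree]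
  simp only [Finset.mem_univ, if_true, nsmul_eq_mul]
  field_simp
  norm_num

theorem walkWeight_nonneg {V : Type*} [Fintype V] {Q : V → V → ℝ} (hQ : ∀ u v, 0 ≤ Q u v)
    (x : V) (t : ℕ) (p : Fin (t + 1) → V) : 0 ≤ walkWeight Q x t p := by
  unfold walkWeight
  have := Finset.prod_nonneg fun (i : Fin t) (_ : i ∈ univ) => hQ (p i.castSucc) (p i.succ)
  split_ifs <;> simp [this]

theorem walkWeight_cons {V : Type*} [Fintype V] (Q : V → V → ℝ) (x z : V) (t : ℕ)
    (p : Fin (t + 1) → V) :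
    walkWeight Q x (t + 1) (Fin.cons z p) =
      if z = x then ∑ w, Q x w * walkWeight Q w t p else 0 := by
  simp only [walkWeight, Fin.cons_zero, Fin.prod_univ_succ, Fin.cons_succ, Fin.castSucc_zero,
    ← Fin.succ_castSucc]
  split_ifs with h
  · subst h
    simp
  · simp

theorem visits_cons {V : Type*} [Fintype V] (t : ℕ) (z y : V) (p : Fin (t + 1) → V) :
    visits (t + 1) (Fin.cons z p) y = (if z = y then 1 else 0) + visits t p y := by
  simp only [visits, Finset.card_filter, Fin.sum_univ_succ (n := t + 1), Fin.cons_zero,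
    Fin.cons_succ]

theorem visitMGF_zero {V : Type*} [Fintype V] (Q : V → V → ℝ) (ε : ℝ) (y x : V) :
    visitMGF Q ε y 0 x = if x = y then Real.exp ε else 1 := by
  rw [visitMGF, ← (Equiv.funUnique (Fin 1) V).symm.sum_comp]
  simp only [walkWeight, visits, Finset.card_filter]
  simp
  split_ifs <;> simp

theorem visitMGF_succ {V : Type*} [Fintype V] (Q : V → V → ℝ) (ε : ℝ) (y : V) (t : ℕ) (x : V) :
    visitMGF Q ε y (t + 1) x =
      (if x = y then Real.exp ε else 1) * ∑ w, Q x w * visitMGF Q ε y t w := by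
  have hcons : ∀ q : V × (Fin (t + 1) → V),
      Fin.consEquiv (fun _ : Fin (t + 2) => V) q = Fin.cons q.1 q.2 := fun _ => rfl
  rw [visitMGF, ← (Fin.consEquiv fun _ : Fin (t + 2) => V).sum_comp, Fintype.sum_prod_type]
  simp only [hcons, walkWeight_cons, visits_cons, ite_mul, zero_mul]
  rw [Finset.sum_eq_single x (by intro z _ hz; simp [hz]) (by simp)]
  simp only [if_true, visitMGF, Finset.mul_sum, Finset.sum_mul]
  rw [Finset.sum_comm]
  split_ifs
  · refine Finset.sum_congr rfl fun w _ => Finset.sum_congr rfl fun p _ => ?_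
    push_cast
    rw [mul_add, Real.exp_add, mul_one]
    ring
  · refine Finset.sum_congr rfl fun w _ => Finset.sum_congr rfl fun p _ => ?_
    simp [mul_assoc]

/-- Khas'minskii's lemma for a finite Markov chain: if the expected number of visits to `y` is at
most `M` from every starting vertex, then the exponential moment of the number of visits is
bounded by `B` as soon as `1 + (exp ε - 1) * B * M ≤ B`. -/
theorem visitMGF_le {V : Type*} [Fintype V] [DecidableEq V] {Q : Matrix V V ℝ}
    (hQ : ∀ u v, 0 ≤ Q u v) (hrow : ∀ u, ∑ v, Q u v = 1) {y : V} {T : ℕ} {M B ε : ℝ}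
    (hM : ∀ x, ∑ i ∈ Finset.range (T + 1), (Q ^ i) x y ≤ M)
    (hε : 0 ≤ ε) (hB1 : 1 ≤ B) (hB : 1 + (Real.exp ε - 1) * B * M ≤ B) (x : V) :
    visitMGF (fun u v => Q u v) ε y T x ≤ B := by
  have hl : 0 ≤ Real.exp ε - 1 := by linarith [Real.add_one_le_exp ε]
  have hpow : ∀ i u v, 0 ≤ (Q ^ i) u v := by
    intro i
    induction i with
    | zero => intro u v; rw [pow_zero, Matrix.one_apply]; split_ifs <;> norm_num
    | succ i ih =>
      intro u v
      rw [pow_succ, Matrix.mul_apply]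
      exact Finset.sum_nonneg fun w _ => mul_nonneg (ih _ _) (hQ _ _)
  have hlB : 0 ≤ (Real.exp ε - 1) * B := mul_nonneg hl (by linarith)
  have htrunc : ∀ t ≤ T, ∀ x,
      1 + (Real.exp ε - 1) * B * ∑ i ∈ Finset.range (t + 1), (Q ^ i) x y ≤ B := by
    intro t ht x
    refine le_trans ?_ hB
    gcongr
    refine le_trans ?_ (hM x)
    exact Finset.sum_le_sum_of_subset_of_nonneg (Finset.range_mono (by omega))
      fun i _ _ => hpow i x y
  have key : ∀ t ≤ T, ∀ x, visitMGF (fun u v => Q u v) ε y t x ≤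
      1 + (Real.exp ε - 1) * B * ∑ i ∈ Finset.range (t + 1), (Q ^ i) x y := by
    intro t
    induction t with
    | zero =>
      intro _ x
      rw [visitMGF_zero]
      simp only [zero_add, Finset.sum_range_one, pow_zero, Matrix.one_apply]
      split_ifs
      · nlinarith
      · simp
    | succ t ih =>
      intro ht x
      have ih' := ih (by omega)
      have hstep : ∑ w, Q x w * visitMGF (fun u v => Q u v) ε y t w ≤
          1 + (Real.exp ε - 1) * B * ∑ i ∈ Finset.range (t + 1), (Q ^ (i + 1)) x y := by
        calc _ ≤ ∑ w, Q x w *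
              (1 + (Real.exp ε - 1) * B * ∑ i ∈ Finset.range (t + 1), (Q ^ i) w y) :=
              Finset.sum_le_sum fun w _ => mul_le_mul_of_nonneg_left (ih' w) (hQ x w)
          _ = _ := by
            simp only [mul_add, mul_one, Finset.sum_add_distrib, hrow, pow_succ',
              Matrix.mul_apply]
            rw [Finset.sum_comm, Finset.mul_sum]
            congr 1
            refine Finset.sum_congr rfl fun w _ => ?_
            rw [← Finset.mul_sum]
            ring
      have hbound : ∑ w, Q x w * visitMGF (fun u v => Q u v) ε y t w ≤ B := by
        calc _ ≤ ∑ w, Q x w * B := Finset.sum_le_sum fun w _ =>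
              mul_le_mul_of_nonneg_left ((ih' w).trans (htrunc t (by omega) w)) (hQ x w)
          _ = B := by rw [← Finset.sum_mul, hrow, one_mul]
      rw [visitMGF_succ, Finset.sum_range_succ', mul_add, pow_zero, Matrix.one_apply]
      split_ifs
      · nlinarith [mul_le_mul_of_nonneg_left hbound hl]
      · linarith
  exact (key T le_rfl x).trans (htrunc T le_rfl x)

/-- Chernoff's bound for the number of visits. -/
theorem walkProb_le_exp_mul_visitMGF {V : Type*} [Fintype V] {Q : V → V → ℝ}
    (hQ : ∀ u v, 0 ≤ Q u v) (x y : V) (t : ℕ) {ε : ℝ} (hε : 0 ≤ ε) (a : ℝ) :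
    walkProb Q x t (fun p => a ≤ (visits t p y : ℝ)) ≤
      Real.exp (-(ε * a)) * visitMGF Q ε y t x := by
  rw [walkProb, visitMGF, Finset.mul_sum]
  refine Finset.sum_le_sum fun p _ => ?_
  have hw := walkWeight_nonneg hQ x t p
  split_ifs with h
  · have hexp : 1 ≤ Real.exp (-(ε * a)) * Real.exp (ε * visits t p y) := by
      rw [← Real.exp_add, Real.one_le_exp_iff]
      nlinarith [mul_le_mul_of_nonneg_left h hε]
    nlinarith [mul_le_mul_of_nonneg_left hexp hw]
  · positivity

/-- **High-probability visit bound for a single walk.** -/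
theorem single_walk_visit_bound
    {V : Type*} [Fintype V] [DecidableEq V]
    (G : SimpleGraph V) [DecidableRel G.Adj]
    (n : ℕ) (hn : n = Fintype.card V) (hn2 : 2 ≤ n)
    (hdeg : ∀ v : V, 0 < G.degree v)
    (t : ℕ) (ht : 1 ≤ t) (y : V)
    (hheat : ∀ x' : V,
      ∑ i ∈ Finset.range (t + 1), (lazyWalk G ^ i) x' y
        ≤ 8 * (G.degree y : ℝ) * Real.sqrt (t + 1)) :
    ∀ x : V,
      walkProb (fun u v => lazyWalk G u v) x t
        (fun p =>
          32 * (G.degree y : ℝ) * Real.sqrt (t + 1) * (Nat.clog 2 n : ℝ)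
            ≤ (visits t p y : ℝ))
        ≤ 1 / (n : ℝ) ^ 2 := by
  intro x
  set L := Nat.clog 2 n
  set M := 8 * (G.degree y : ℝ) * Real.sqrt (t + 1)
  have hM11 : 11 ≤ M := by
    have hd : (1 : ℝ) ≤ G.degree y := by exact_mod_cast hdeg y
    have ht' : (1 : ℝ) ≤ t := by exact_mod_cast ht
    have hs : (11 / 8 : ℝ) ≤ Real.sqrt (t + 1) := Real.le_sqrt_of_sq_le (by linarith)
    have := mul_le_mul hd hs (by norm_num) (by linarith)
    simp only [M]
    linarith
  have hM0 : 0 < M := by linarith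
  have hlog0 : 0 < Real.log 2 := Real.log_pos one_lt_two
  have hlog : Real.log 2 ≤ 0.7 := by linarith [Real.log_two_lt_d9]
  set ε := Real.log 2 / M
  have hε0 : 0 ≤ ε := by positivity
  have hεM : ε * M = Real.log 2 := div_mul_cancel₀ _ hM0.ne'
  have hε : ε ≤ 0.07 := by
    rw [div_le_iff₀ hM0]
    linarith
  have hexp : Real.exp ε - 1 ≤ ε + ε ^ 2 := by
    have := (abs_le.mp (Real.abs_exp_sub_one_sub_id_le (x := ε)
      (abs_le.mpr ⟨by linarith, by linarith⟩))).2
    linarith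
  have hB : 1 + (Real.exp ε - 1) * 4 * M ≤ 4 := by
    nlinarith [mul_le_mul_of_nonneg_right hexp hM0.le, mul_le_mul_of_nonneg_right hε hlog0.le]
  have hmgf := visitMGF_le (lazyWalk_nonneg G) (fun u => lazyWalk_row_sum G (hdeg u)) hheat hε0
    (by norm_num) hB x
  have hch := walkProb_le_exp_mul_visitMGF (lazyWalk_nonneg G) x y t hε0
    (32 * (G.degree y : ℝ) * Real.sqrt (t + 1) * (L : ℝ))
  refine hch.trans ((mul_le_mul_of_nonneg_left hmgf (Real.exp_pos _).le).trans ?_)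
  have hεa : ε * (32 * (G.degree y : ℝ) * Real.sqrt (t + 1) * (L : ℝ)) =
      ((4 * L : ℕ) : ℝ) * Real.log 2 := by
    rw [← hεM]
    simp only [M]
    push_cast
    ring
  have hL : 1 ≤ L := Nat.clog_pos (by norm_num) hn2
  have hnL : (n : ℝ) ≤ 2 ^ L := by exact_mod_cast Nat.le_pow_clog (by norm_num) n
  have hn0 : (0 : ℝ) < n := by positivity
  have h2L : (2 : ℝ) ≤ 2 ^ L := by
    simpa using pow_le_pow_right₀ (by norm_num : (1 : ℝ) ≤ 2) hL
  rw [hεa, Real.exp_neg, Real.exp_nat_mul, Real.exp_log two_pos, mul_comm 4 L, pow_mul,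
    inv_mul_eq_div, div_le_div_iff₀ (by positivity) (by positivity)]
  have hsq : (n : ℝ) ^ 2 ≤ (2 ^ L) ^ 2 := by gcongr
  have h4 : (4 : ℝ) ≤ (2 ^ L) ^ 2 := by nlinarith
  nlinarith
end

section
/- Connector-appearance bound: Let a_1, …, a_ℓ be a fixed finite sequence of elements, let λ ≥ 1 be an integer, and let r_1, r_2, … be independent random variables, each uniform on {0, 1, …, λ−1}. Define connector positions p_j = j·λ + r_1 + ⋯ + r_j for j = 1, 2, …, and let the connector subsequence consist of the elements a_{p_j} for those j with p_j ≤ ℓ. Let v be a value that appears at most t times among a_1, …, a_ℓ, let n ≥ 2 be an integer, and set R = t·(log₂ n)²/λ. If R ≥ 6·t/λ (i.e. (log₂ n)² ≥ 6) and R ≥ 2·log₂ n, then the probability that v appears more than R times in the connector subsequence is at most 1/n². -/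
open Finset

attribute [local instance] Classical.propDecidable

/-- Given the random offsets `r 0, …` (each in `{0,…,λ-1}`), the `j`-th
connector position is `p_j = j·λ + r_1 + ⋯ + r_j`. -/
def connectorPos {J lam : ℕ} (r : Fin J → Fin lam) (j : ℕ) : ℕ :=
  j * lam + ∑ i ∈ Finset.univ.filter (fun i : Fin J => (i : ℕ) < j), (r i : ℕ)

lemma connectorPos_cons {J lam : ℕ} (x : Fin lam) (r : Fin J → Fin lam) (k : ℕ) :
    connectorPos (Fin.cons x r : Fin (J + 1) → Fin lam) (k + 1)
      = lam + x + connectorPos r k := by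
  simp only [connectorPos, Finset.sum_filter, Fin.sum_univ_succ, Fin.cons_zero, Fin.cons_succ,
    Fin.val_zero, Fin.val_succ, Nat.succ_pos, if_true, Nat.add_lt_add_iff_right]
  ring

lemma connectorPos_zero {J lam : ℕ} (r : Fin J → Fin lam) : connectorPos r 0 = 0 := by
  simp [connectorPos]

/-- A window of `lam` consecutive positions, each hit weighted by `4`. -/
lemma sum_window_weight_le (S : Finset ℕ) {lam : ℕ} (hlam : 1 ≤ lam) (u : ℕ) :
    ∑ x : Fin lam, (if u + x ∈ S then (4 : ℝ) else 1)
      ≤ lam * Real.exp (3 * ((S.filter fun i => u ≤ i ∧ i < u + lam).card : ℝ) / lam) := by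
  have hpos : (0 : ℝ) < lam := by exact_mod_cast hlam
  have hcard : ((Finset.univ.filter fun x : Fin lam => u + x ∈ S).card : ℝ)
      ≤ ((S.filter fun i => u ≤ i ∧ i < u + lam).card : ℝ) := by
    norm_cast
    refine Finset.card_le_card_of_injOn (fun x : Fin lam => u + x) ?_ ?_
    · intro x hx
      have hxS : u + (x : ℕ) ∈ S := by simpa using hx
      simp [hxS]
    · intro x _ y _ hxy
      exact Fin.ext (Nat.add_left_cancel hxy)
  have hsum : ∑ x : Fin lam, (if u + x ∈ S then (4 : ℝ) else 1)
      = lam + 3 * ((Finset.univ.filter fun x : Fin lam => u + x ∈ S).card : ℝ) := by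
    have hsplit : ∀ x : Fin lam, (if u + x ∈ S then (4 : ℝ) else 1)
        = 1 + 3 * (if u + x ∈ S then (1 : ℝ) else 0) := by
      intro x
      split_ifs <;> norm_num
    simp only [hsplit, Finset.sum_add_distrib, ← Finset.mul_sum, Finset.sum_boole]
    simp
  set c : ℝ := ((S.filter fun i => u ≤ i ∧ i < u + lam).card : ℝ)
  calc _ ≤ (lam : ℝ) + 3 * c := by rw [hsum]; gcongr
    _ = lam * (3 * c / lam + 1) := by field_simp; ring
    _ ≤ _ := by gcongr; exact Real.add_one_le_exp _

/-- Exponential moment of the number of visits of the shifted connector positions to `S`.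
Consecutive windows of possible positions are disjoint, so only `S.card` matters. -/
lemma sum_prod_connectorPos_le (S : Finset ℕ) {lam : ℕ} (hlam : 1 ≤ lam) (J s : ℕ) :
    ∑ r : Fin J → Fin lam,
        ∏ j : Fin J, (if s + connectorPos r (j + 1) ∈ S then (4 : ℝ) else 1)
      ≤ (lam : ℝ) ^ J * Real.exp (3 * ((S.filter fun i => s + lam ≤ i).card : ℝ) / lam) := by
  induction J generalizing s with
  | zero =>
    simp only [Finset.univ_eq_empty, Finset.prod_empty, Finset.sum_const, Finset.card_univ,
      Fintype.card_unique, one_smul, pow_zero, one_mul]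
    exact Real.one_le_exp (by positivity)
  | succ J ih =>
    rw [← (Fin.consEquiv fun _ : Fin (J + 1) => Fin lam).sum_comp, Fintype.sum_prod_type]
    have hstep : ∀ x : Fin lam, ∑ r : Fin J → Fin lam, ∏ j : Fin (J + 1),
        (if s + connectorPos (Fin.cons x r : Fin (J + 1) → Fin lam) (j + 1) ∈ S
          then (4 : ℝ) else 1)
        ≤ (if s + lam + x ∈ S then (4 : ℝ) else 1) * ((lam : ℝ) ^ J *
          Real.exp (3 * ((S.filter fun i => s + lam + lam ≤ i).card : ℝ) / lam)) := by
      intro x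
      simp only [connectorPos_cons, Fin.prod_univ_succ, Fin.val_zero, connectorPos_zero,
        Fin.val_succ, add_zero, ← Finset.mul_sum, ← add_assoc]
      have hcard : (S.filter fun i => s + lam + x + lam ≤ i).card
          ≤ (S.filter fun i => s + lam + lam ≤ i).card :=
        Finset.card_le_card (Finset.monotone_filter_right S fun i _ hi => by omega)
      refine mul_le_mul_of_nonneg_left ((ih (s + lam + x)).trans ?_) (by split_ifs <;> norm_num)
      gcongr
    refine (Finset.sum_le_sum fun x _ => hstep x).trans ?_
    rw [← Finset.sum_mul]
    have hsplit : (S.filter fun i => s + lam ≤ i).card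
        = (S.filter fun i => s + lam ≤ i ∧ i < s + lam + lam).card
          + (S.filter fun i => s + lam + lam ≤ i).card := by
      rw [← Finset.card_union_of_disjoint]
      · congr 1
        ext i
        simp only [Finset.mem_filter, Finset.mem_union]
        grind
      · rw [Finset.disjoint_filter]
        intro i _ h
        omega
    refine (mul_le_mul_of_nonneg_right (sum_window_weight_le S hlam (s + lam))
      (by positivity)).trans_eq ?_
    rw [hsplit, Nat.cast_add, mul_add, add_div, Real.exp_add]
    ring

lemma prod_ite_connectorPos_eq_pow {J lam : ℕ} (S : Finset ℕ) (r : Fin J → Fin lam) :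
    ∏ j : Fin J, (if connectorPos r (j + 1) ∈ S then (4 : ℝ) else 1)
      = 4 ^ ((Finset.Icc 1 J).filter fun j => connectorPos r j ∈ S).card := by
  rw [Fin.prod_univ_eq_prod_range (fun j => if connectorPos r (j + 1) ∈ S then (4 : ℝ) else 1) J,
    Finset.range_eq_Ico,
    Finset.prod_Ico_add' (fun j => if connectorPos r j ∈ S then (4 : ℝ) else 1) 0 J 1,
    ← Finset.prod_const, Finset.prod_filter]
  rfl

/-- Markov's inequality for the exponential moment. -/
lemma card_filter_mul_four_rpow_le {J lam : ℕ} (hlam : 1 ≤ lam) (S : Finset ℕ) (R : ℝ) :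
    ((Finset.univ.filter fun r : Fin J → Fin lam =>
        R < (((Finset.Icc 1 J).filter fun j => connectorPos r j ∈ S).card : ℝ)).card : ℝ)
      * (4 : ℝ) ^ R ≤ (lam : ℝ) ^ J * Real.exp (3 * (S.card : ℝ) / lam) := by
  set B := Finset.univ.filter fun r : Fin J → Fin lam =>
    R < (((Finset.Icc 1 J).filter fun j => connectorPos r j ∈ S).card : ℝ)
  have hsum := sum_prod_connectorPos_le S hlam J 0
  simp only [zero_add, prod_ite_connectorPos_eq_pow] at hsum
  calc (B.card : ℝ) * (4 : ℝ) ^ R = ∑ _r ∈ B, (4 : ℝ) ^ R := by simp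
    _ ≤ ∑ r ∈ B, (4 : ℝ) ^ ((Finset.Icc 1 J).filter fun j => connectorPos r j ∈ S).card := by
        refine Finset.sum_le_sum fun r hr => ?_
        rw [← Real.rpow_natCast]
        exact Real.rpow_le_rpow_of_exponent_le (by norm_num) (Finset.mem_filter.1 hr).2.le
    _ ≤ ∑ r : Fin J → Fin lam,
          (4 : ℝ) ^ ((Finset.Icc 1 J).filter fun j => connectorPos r j ∈ S).card :=
        Finset.sum_le_univ_sum_of_nonneg fun r => by positivity
    _ ≤ _ := hsum
    _ ≤ _ := by
        gcongr
        exact Finset.filter_subset _ _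

lemma exp_half_mul_two_rpow_le {R : ℝ} (hR : 0 ≤ R) :
    Real.exp (R / 2) * (2 : ℝ) ^ R ≤ (4 : ℝ) ^ R := by
  have hexp : Real.exp (1 / 2) ≤ 2 := by
    rw [← Real.le_log_iff_exp_le (by norm_num)]
    linarith [Real.log_two_gt_d9]
  calc Real.exp (R / 2) * (2 : ℝ) ^ R = Real.exp (1 / 2) ^ R * (2 : ℝ) ^ R := by
        rw [← Real.exp_mul]; ring_nf
    _ ≤ (2 : ℝ) ^ R * (2 : ℝ) ^ R := by gcongr
    _ = (4 : ℝ) ^ R := by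
        rw [← Real.mul_rpow (by norm_num) (by norm_num)]; norm_num

/-- **Connector-appearance bound.** If a value `v` appears at most `t` times
among `a 1, …, a ℓ`, and `R = t (log₂ n)² / λ` satisfies `R ≥ 6t/λ` and
`R ≥ 2 log₂ n`, then the probability (over the independent uniform offsets)
that `v` appears more than `R` times in the connector subsequence is at
most `1/n²`. -/
theorem connector_appearance_bound
    {α : Type*} (ℓ lam t n : ℕ) (hlam : 1 ≤ lam) (hn : 2 ≤ n)
    (a : ℕ → α) (v : α)
    (ht : ((Finset.Icc 1 ℓ).filter fun i => a i = v).card ≤ t)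
    (R : ℝ) (hR : R = (t : ℝ) * Real.logb 2 n ^ 2 / (lam : ℝ))
    (hR6 : 6 * (t : ℝ) / (lam : ℝ) ≤ R)
    (hR2 : 2 * Real.logb 2 n ≤ R) :
    (((Finset.univ : Finset (Fin (ℓ / lam) → Fin lam)).filter fun r =>
        R < (((Finset.Icc 1 (ℓ / lam)).filter fun j =>
            connectorPos r j ≤ ℓ ∧ a (connectorPos r j) = v).card : ℝ)).card : ℝ)
      / (lam : ℝ) ^ (ℓ / lam) ≤ 1 / (n : ℝ) ^ 2 := by
  have hlam0 : (0 : ℝ) < lam := by exact_mod_cast hlam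
  have hn0 : (0 : ℝ) < n := by exact_mod_cast (by omega : 0 < n)
  set S := (Finset.Icc 1 ℓ).filter fun i => a i = v
  have hmem : ∀ r : Fin (ℓ / lam) → Fin lam,
      ((Finset.Icc 1 (ℓ / lam)).filter fun j =>
        connectorPos r j ≤ ℓ ∧ a (connectorPos r j) = v)
      = (Finset.Icc 1 (ℓ / lam)).filter fun j => connectorPos r j ∈ S := by
    intro r
    refine Finset.filter_congr fun j hj => ?_
    have hpos : 1 ≤ connectorPos r j :=
      (Nat.mul_pos (Finset.mem_Icc.1 hj).1 hlam).trans_le (Nat.le_add_right _ _)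
    simp [S, hpos]
  simp only [hmem]
  have hmarkov := card_filter_mul_four_rpow_le (J := ℓ / lam) hlam S R
  set B : ℝ := ((Finset.univ.filter fun r : Fin (ℓ / lam) → Fin lam =>
    R < (((Finset.Icc 1 (ℓ / lam)).filter fun j => connectorPos r j ∈ S).card : ℝ)).card : ℝ)
  have hR0 : 0 ≤ R := hR ▸ by positivity
  have hS : 3 * (S.card : ℝ) / lam ≤ R / 2 := by
    have hcard : 3 * (S.card : ℝ) / lam ≤ 3 * (t : ℝ) / lam := by gcongr
    have hhalf : 3 * (t : ℝ) / lam = 6 * (t : ℝ) / lam / 2 := by ring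
    linarith
  have hn2 : (n : ℝ) ^ 2 ≤ (2 : ℝ) ^ R := by
    calc (n : ℝ) ^ 2 = (2 : ℝ) ^ (2 * Real.logb 2 n) := by
          rw [mul_comm, Real.rpow_mul (by norm_num),
            Real.rpow_logb (by norm_num) (by norm_num) hn0, Real.rpow_two]
      _ ≤ (2 : ℝ) ^ R := Real.rpow_le_rpow_of_exponent_le (by norm_num) hR2
  rw [div_le_div_iff₀ (by positivity) (by positivity), one_mul]
  have hbound : Real.exp (R / 2) * (B * (2 : ℝ) ^ R)
      ≤ Real.exp (R / 2) * (lam : ℝ) ^ (ℓ / lam) := by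
    calc Real.exp (R / 2) * (B * (2 : ℝ) ^ R) = B * (Real.exp (R / 2) * (2 : ℝ) ^ R) := by ring
      _ ≤ B * (4 : ℝ) ^ R := by gcongr; exact exp_half_mul_two_rpow_le hR0
      _ ≤ (lam : ℝ) ^ (ℓ / lam) * Real.exp (3 * (S.card : ℝ) / lam) := hmarkov
      _ ≤ (lam : ℝ) ^ (ℓ / lam) * Real.exp (R / 2) := by gcongr
      _ = _ := mul_comm _ _
  exact (mul_le_mul_of_nonneg_left hn2 (by positivity)).trans
    (le_of_mul_le_mul_left hbound (Real.exp_pos _))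
end

section
/- Expected edge congestion for the Metropolis–Hastings walk: Let G be a finite undirected simple graph in which every vertex has positive degree, let π be a probability distribution on the vertices with π(v) > 0 for all v, let 0 < α < 1, and let P be the Metropolis–Hastings transition matrix defined by P(x,y) = α·min(1/deg(x), π(y)/(π(x)·deg(y))) for each edge {x,y}, P(x,y) = 0 for non-adjacent x ≠ y, and P(x,x) = 1 − ∑_{y ≠ x} P(x,y). Let η > 0 and suppose each vertex v initially holds w(v) = η·π(v)/(α·min_z π(z)/deg(z)) tokens, each performing an independent walk with transitions P. Then for every integer j ≥ 0 and vertex v, the expected number of tokens at v after j steps, ∑_u w(u)·P^j(u,v), equals w(v); and for every edge e = {x,y} and every integer j ≥ 1, the expected number of tokens sent through e in the j-th step, ∑_u w(u)·(P^{j−1}(u,x)·P(x,y) + P^{j−1}(u,y)·P(y,x)), is at most 2η·(max_z π(z)/deg(z))/(min_z π(z)/deg(z)). -/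
open Finset

/-- A distribution in detailed balance with a matrix of row sums one is stationary
for all powers of that matrix. -/
theorem sum_mul_pow_of_detailed_balance {V R : Type*} [Fintype V] [DecidableEq V] [CommSemiring R]
    {P : Matrix V V R} {w : V → R} (hrow : ∀ x, ∑ y, P x y = 1)
    (hbal : ∀ x y, w x * P x y = w y * P y x) (j : ℕ) (v : V) :
    ∑ u, w u * (P ^ j) u v = w v := by
  have hstat : Matrix.vecMul w P = w := by
    funext v
    simp only [Matrix.vecMul, dotProduct]
    rw [Finset.sum_congr rfl fun u _ => hbal u v, ← Finset.mul_sum, hrow, mul_one]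
  have hpow : Matrix.vecMul w (P ^ j) = w := by
    induction j with
    | zero => simp
    | succ k ih => rw [pow_succ, ← Matrix.vecMul_vecMul, ih, hstat]
  exact congrFun hpow v

/-- The Metropolis–Hastings flow along an edge is symmetric in its endpoints. -/
theorem mul_metropolis_hastings_eq {p q a b α : ℝ} (hp : 0 < p) :
    p * (α * min (1 / a) (q / (p * b))) = α * min (p / a) (q / b) := by
  rw [mul_left_comm, mul_min_of_nonneg _ _ hp.le, mul_one_div, ← mul_div_assoc,
    mul_div_mul_left _ _ hp.ne']

/-- **Expected edge congestion for the Metropolis–Hastings walk.**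
If each vertex `v` starts with `w(v) = η·π(v)/(α·min_z π(z)/deg(z))` tokens,
each performing an independent walk with the Metropolis–Hastings transition
matrix `P`, then the expected number of tokens at `v` after any number of
steps is `w(v)`, and the expected number of tokens sent through any edge
`{x,y}` in any step is at most
`2η·(max_z π(z)/deg(z))/(min_z π(z)/deg(z))`. -/
theorem metropolis_hastings_edge_congestion
    {V : Type*} [Fintype V] [DecidableEq V] [Nonempty V]
    (G : SimpleGraph V) [DecidableRel G.Adj]
    (hdeg : ∀ v : V, 0 < G.degree v)
    (π : V → ℝ) (hπpos : ∀ v, 0 < π v) (hπ1 : ∑ v, π v = 1)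
    (α : ℝ) (hα0 : 0 < α) (hα1 : α < 1)
    (P : Matrix V V ℝ)
    (hPadj : ∀ x y : V, G.Adj x y →
      P x y = α * min (1 / (G.degree x : ℝ)) (π y / (π x * (G.degree y : ℝ))))
    (hPnon : ∀ x y : V, x ≠ y → ¬G.Adj x y → P x y = 0)
    (hPdiag : ∀ x : V, P x x = 1 - ∑ y ∈ Finset.univ.erase x, P x y)
    (η : ℝ) (hη : 0 < η)
    (w : V → ℝ)
    (hw : ∀ v : V, w v = η * π v /
      (α * Finset.univ.inf' Finset.univ_nonempty (fun z : V => π z / (G.degree z : ℝ)))) :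
    (∀ (j : ℕ) (v : V), ∑ u, w u * (P ^ j) u v = w v) ∧
    (∀ x y : V, G.Adj x y → ∀ j : ℕ, 1 ≤ j →
      ∑ u, w u * ((P ^ (j - 1)) u x * P x y + (P ^ (j - 1)) u y * P y x)
        ≤ 2 * η *
          Finset.univ.sup' Finset.univ_nonempty (fun z : V => π z / (G.degree z : ℝ)) /
          Finset.univ.inf' Finset.univ_nonempty (fun z : V => π z / (G.degree z : ℝ))) := by
  have hflow : ∀ x y, G.Adj x y →
      π x * P x y = α * min (π x / (G.degree x : ℝ)) (π y / (G.degree y : ℝ)) := by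
    intro x y hxy
    rw [hPadj x y hxy, mul_metropolis_hastings_eq (hπpos x)]
  have hπbal : ∀ x y, π x * P x y = π y * P y x := by
    intro x y
    by_cases hne : x = y
    · rw [hne]
    by_cases hxy : G.Adj x y
    · rw [hflow x y hxy, hflow y x hxy.symm, min_comm]
    · rw [hPnon x y hne hxy, hPnon y x (Ne.symm hne) fun h => hxy h.symm, mul_zero, mul_zero]
  have hrow : ∀ x, ∑ y, P x y = 1 := by
    intro x
    rw [← Finset.add_sum_erase _ _ (Finset.mem_univ x), hPdiag x]
    ring
  set m := Finset.univ.inf' Finset.univ_nonempty (fun z : V => π z / (G.degree z : ℝ)) with hm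
  have hmpos : 0 < m := by
    rw [hm, Finset.lt_inf'_iff]
    exact fun z _ => div_pos (hπpos z) (Nat.cast_pos.mpr (hdeg z))
  have hwP : ∀ x y, w x * P x y = η / (α * m) * (π x * P x y) := by
    intro x y
    rw [hw x]
    ring
  have hstat := sum_mul_pow_of_detailed_balance (w := w) hrow fun x y => by
    rw [hwP, hwP, hπbal]
  refine ⟨hstat, fun x y hxy j _ => ?_⟩
  have hsum : ∑ u, w u * ((P ^ (j - 1)) u x * P x y + (P ^ (j - 1)) u y * P y x)
      = w x * P x y + w y * P y x := by
    simp only [mul_add, ← mul_assoc, Finset.sum_add_distrib, ← Finset.sum_mul, hstat]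
  calc _ = 2 * η * min (π x / (G.degree x : ℝ)) (π y / (G.degree y : ℝ)) / m := by
        rw [hsum, hwP, hwP, hπbal y x, hflow x y hxy]
        field_simp
        ring
    _ ≤ _ := by
        gcongr
        exact (min_le_left _ _).trans
          (Finset.le_sup' (fun z : V => π z / (G.degree z : ℝ)) (Finset.mem_univ x))
end
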